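/- There exist absolute constants c > 0 and e > 0 such that the following holds. Let P ∈ ℝ[x,y] be irreducible of degree d, let Γ = {(x,y) ∈ ℝ² : P(x,y) = 0} and assume Γ is infinite. Let k be an integer with 1 ≤ k < d. Then the set Γ ∩ Σ_k is finite and has at most c·d²·k^e elements. -/

import Mathlib

/-- Evaluation of a polynomial in two variables at a point of `ℝ²`. -/
noncomputable def evalRR (Q : MvPolynomial (Fin 2) ℝ) (p : ℝ × ℝ) : ℝ :=
  MvPolynomial.eval ![p.1, p.2] Q

/-- The derivation `L = L_P = P_y ∂/∂x - P_x ∂/∂y` applied to `Q`. -/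
noncomputable def Lop (P Q : MvPolynomial (Fin 2) ℝ) : MvPolynomial (Fin 2) ℝ :=
  MvPolynomial.pderiv 1 P * MvPolynomial.pderiv 0 Q -
    MvPolynomial.pderiv 0 P * MvPolynomial.pderiv 1 Q

/-- `f : Fin μ → ℝ[x,y]` is an enumeration of the monomials `x^a y^b` with `a + b ≤ k`. -/
def IsMonomialEnum (k : ℕ) {μ : ℕ} (f : Fin μ → MvPolynomial (Fin 2) ℝ) : Prop :=
  Function.Injective f ∧
    Set.range f =
      {q | ∃ a b : ℕ, a + b ≤ k ∧ q = MvPolynomial.X 0 ^ a * MvPolynomial.X 1 ^ b}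

/-- The `j`-th partial `ξ`-Wronskian: the determinant of the `j × j` matrix with
`(i, m)` entry `L^{i-1} f_m` (with `0`-based indexing, `L^i f_m`). -/
noncomputable def xiWronskian (P : MvPolynomial (Fin 2) ℝ) {μ : ℕ}
    (f : Fin μ → MvPolynomial (Fin 2) ℝ) (j : ℕ) (hj : j ≤ μ) : MvPolynomial (Fin 2) ℝ :=
  Matrix.det (Matrix.of fun i m : Fin j => (Lop P)^[(i : ℕ)] (f (Fin.castLE hj m)))

/-- The set `Σ_k`: the union of `{P_x = P_y = P = 0}` with the zero sets of the
partial `ξ`-Wronskians `W_j` for `j = 1, …, μ`. -/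
noncomputable def SigmaSet (P : MvPolynomial (Fin 2) ℝ) {μ : ℕ}
    (f : Fin μ → MvPolynomial (Fin 2) ℝ) : Set (ℝ × ℝ) :=
  {p | (evalRR (MvPolynomial.pderiv 0 P) p = 0 ∧ evalRR (MvPolynomial.pderiv 1 P) p = 0 ∧
          evalRR P p = 0) ∨
       ∃ (j : ℕ) (hj : j ≤ μ), 1 ≤ j ∧ evalRR (xiWronskian P f j hj) p = 0}


open MvPolynomial in
lemma finrank_V (N : ℕ) : 2 * Module.finrank ℝ (restrictTotalDegree (Fin 2) ℝ N)
    = (N + 1) * (N + 2) := by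
  have h1 : Module.finrank ℝ (restrictTotalDegree (Fin 2) ℝ N)
      = Nat.card {n : Fin 2 →₀ ℕ | (n.sum fun _ e => e) ≤ N} :=
    Module.finrank_eq_nat_card_basis (basisRestrictSupport ℝ {n : Fin 2 →₀ ℕ | (n.sum fun _ e => e) ≤ N})
  have hs : ∀ n : Fin 2 →₀ ℕ, (n.sum fun _ e => e) = n 0 + n 1 := fun n => by
    rw [Finsupp.sum_fintype _ _ (fun _ => rfl), Fin.sum_univ_two]
  have e : {n : Fin 2 →₀ ℕ | (n.sum fun _ e => e) ≤ N} ≃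
      ((Finset.range (N + 1)).sigma fun a => Finset.range (N + 1 - a) : Finset (Σ _ : ℕ, ℕ)) :=
    { toFun := fun n => ⟨⟨n.1 0, n.1 1⟩, by
        have := n.2
        rw [Set.mem_ofPred_eq, hs] at this
        simp; omega⟩
      invFun := fun s => ⟨Finsupp.equivFunOnFinite.symm ![s.1.1, s.1.2], by
        have := s.2
        simp only [Finset.mem_sigma, Finset.mem_range] at this
        rw [Set.mem_ofPred_eq, hs]
        simp; omega⟩
      left_inv := fun n => by
        ext i; fin_cases i <;> simp
      right_inv := fun s => by
        ext <;> simp }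
  rw [h1, Nat.card_congr e, Nat.card_eq_fintype_card, Fintype.card_coe, Finset.card_sigma]
  simp only [Finset.card_range]
  have := Finset.sum_range_reflect (fun i => i) (N + 2)
  have h3 := Finset.sum_range_id_mul_two (N + 2)
  have : ∑ x ∈ Finset.range (N + 1), (N + 1 - x) = ∑ i ∈ Finset.range (N + 2), i := by
    rw [← this, Finset.sum_range_succ _ (N + 1)]
    simp
  rw [this, mul_comm, h3]; simp [mul_comm]

lemma finrank_map_inj {V : Type*} [AddCommGroup V] [Module ℝ V] (g : V →ₗ[ℝ] V)
    (hg : Function.Injective g) (W : Submodule ℝ V) :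
    Module.finrank ℝ (W.map g) = Module.finrank ℝ W :=
  (LinearEquiv.finrank_eq (Submodule.equivMapOfInjective g hg W)).symm

open MvPolynomial in
/-- separation of points by polynomials of bounded degree -/
lemma sep_points (S : Finset (ℝ × ℝ)) (N : ℕ) (hN : S.card ≤ N) (p : ℝ × ℝ) :
    ∃ Q : MvPolynomial (Fin 2) ℝ, Q.totalDegree ≤ N ∧ evalRR Q p ≠ 0 ∧
      ∀ q ∈ S, q ≠ p → evalRR Q q = 0 := by
  classical
  let l : ℝ × ℝ → MvPolynomial (Fin 2) ℝ := fun q =>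
    C (p.1 - q.1) * (X 0 - C q.1) + C (p.2 - q.2) * (X 1 - C q.2)
  refine ⟨∏ q ∈ S.erase p, l q, ?_, ?_, ?_⟩
  · refine (totalDegree_finsetProd _ _).trans ?_
    refine (Finset.sum_le_card_nsmul _ _ 1 ?_).trans ?_
    · intro q _
      refine (totalDegree_add _ _).trans (max_le ?_ ?_) <;>
      · refine (totalDegree_mul _ _).trans ?_
        rw [totalDegree_C, zero_add]
        refine (totalDegree_sub_C_le _ _).trans ?_
        simp
    · simpa using (Finset.card_le_card (Finset.erase_subset p S)).trans hN
  · simp only [evalRR, map_prod]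
    rw [Finset.prod_ne_zero_iff]
    intro q hq h
    simp [l] at h
    apply (Finset.mem_erase.mp hq).1
    ext <;> nlinarith [mul_self_nonneg (p.1 - q.1), mul_self_nonneg (p.2 - q.2)]
  · intro q hq hqp
    simp only [evalRR, map_prod]
    refine Finset.prod_eq_zero (Finset.mem_erase.mpr ⟨hqp, hq⟩) ?_
    simp [l]

open MvPolynomial in
lemma bezout_card (P Q : MvPolynomial (Fin 2) ℝ) (hP : Irreducible P) (hQ : ¬ P ∣ Q)
    (S : Finset (ℝ × ℝ)) (hS : ∀ p ∈ S, evalRR P p = 0 ∧ evalRR Q p = 0) :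
    S.card ≤ P.totalDegree * Q.totalDegree := by
  classical
  have hP0 : P ≠ 0 := hP.ne_zero
  have hQ0 : Q ≠ 0 := fun h => hQ (h ▸ dvd_zero P)
  have hPp : Prime P := hP.prime
  set d := P.totalDegree with hd
  set e := Q.totalDegree with he
  set M := S.card with hM
  let V : ℕ → Submodule ℝ (MvPolynomial (Fin 2) ℝ) := fun N => restrictTotalDegree (Fin 2) ℝ N
  have hinj : ∀ R : MvPolynomial (Fin 2) ℝ, R ≠ 0 → Function.Injective (LinearMap.mulLeft ℝ R) :=
    fun R hR => mul_right_injective₀ hR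
  let A := (V (e + M)).map (LinearMap.mulLeft ℝ P)
  let B := (V (d + M)).map (LinearMap.mulLeft ℝ Q)
  let D := (V M).map (LinearMap.mulLeft ℝ (P * Q))
  have hfV : ∀ N, FiniteDimensional ℝ (V N) := fun N => by
    dsimp [V]; infer_instance
  have hAB : A ⊓ B ≤ D := by
    rintro x ⟨⟨a, ha, rfl⟩, ⟨b, hb, hab⟩⟩
    simp only [LinearMap.mulLeft_apply, V, SetLike.mem_coe, mem_restrictTotalDegree] at *
    have : P ∣ Q * b := ⟨a, hab⟩
    obtain ⟨c, rfl⟩ := (hPp.dvd_or_dvd this).resolve_left hQ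
    refine ⟨c, ?_, ?_⟩
    · simp only [V, SetLike.mem_coe, mem_restrictTotalDegree]
      rcases eq_or_ne c 0 with rfl | hc
      · simp
      · rw [totalDegree_mul_of_isDomain hP0 hc] at hb
        omega
    · simp only [LinearMap.mulLeft_apply]
      rw [← hab]; ring
  let ev : MvPolynomial (Fin 2) ℝ →ₗ[ℝ] (S → ℝ) :=
    LinearMap.pi fun p => (MvPolynomial.aeval (R := ℝ) ![p.1.1, p.1.2]).toLinearMap
  have hev : ∀ R p, ev R p = evalRR R p.1 := fun R p => by
    simp [ev, evalRR, MvPolynomial.aeval_eq_eval]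
  let N := d + e + M
  let evN := ev.domRestrict (V N)
  have hsurj : LinearMap.range evN = ⊤ := by
    rw [eq_top_iff, ← (Pi.basisFun ℝ S).span_eq, Submodule.span_le]
    rintro _ ⟨p, rfl⟩
    obtain ⟨R, h1, h2, h3⟩ := sep_points S N (by omega) p.1
    refine ⟨⟨C (evalRR R p.1)⁻¹ * R, ?_⟩, ?_⟩
    · simp only [V, mem_restrictTotalDegree]
      refine (totalDegree_mul _ _).trans ?_
      simpa using h1
    · ext q
      simp only [evN, LinearMap.domRestrict_apply, hev]
      by_cases hpq : q = p
      · subst hpq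
        simp only [Pi.basisFun_apply, Pi.single_eq_same]
        simp only [evalRR, map_mul, eval_C] at h2 ⊢
        exact inv_mul_cancel₀ h2
      · have := h3 q.1 q.2 (fun h => hpq (Subtype.ext h))
        simp only [Pi.basisFun_apply, Pi.single_eq_of_ne hpq]
        simp only [evalRR, map_mul, eval_C] at this ⊢
        rw [this, mul_zero]
  have hker : A ⊔ B ≤ (LinearMap.ker evN).map (V N).subtype := by
    refine sup_le ?_ ?_
    · rintro _ ⟨a, ha, rfl⟩
      simp only [V, SetLike.mem_coe, mem_restrictTotalDegree] at ha
      refine ⟨⟨P * a, ?_⟩, ?_, rfl⟩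
      · simp only [V, mem_restrictTotalDegree]
        exact (totalDegree_mul _ _).trans (by omega)
      · simp only [SetLike.mem_coe, LinearMap.mem_ker]
        ext p
        simp only [evN, LinearMap.domRestrict_apply, hev]
        have := (hS p.1 p.2).1
        simp only [evalRR, map_mul] at this ⊢
        simp [this]
    · rintro _ ⟨a, ha, rfl⟩
      simp only [V, SetLike.mem_coe, mem_restrictTotalDegree] at ha
      refine ⟨⟨Q * a, ?_⟩, ?_, rfl⟩
      · simp only [V, mem_restrictTotalDegree]
        exact (totalDegree_mul _ _).trans (by omega)
      · simp only [SetLike.mem_coe, LinearMap.mem_ker]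
        ext p
        simp only [evN, LinearMap.domRestrict_apply, hev]
        have := (hS p.1 p.2).2
        simp only [evalRR, map_mul] at this ⊢
        simp [this]
  have r1 := evN.finrank_range_add_finrank_ker
  rw [hsurj, finrank_top, Module.finrank_fintype_fun_eq_card, Fintype.card_coe] at r1
  have r2 := Submodule.finrank_mono hker
  rw [Submodule.finrank_map_subtype_eq] at r2
  have r3 := Submodule.finrank_sup_add_finrank_inf_eq A B
  have r4 := Submodule.finrank_mono hAB
  have rA : Module.finrank ℝ A = _ := finrank_map_inj _ (hinj P hP0) (V (e + M))
  have rB : Module.finrank ℝ B = _ := finrank_map_inj _ (hinj Q hQ0) (V (d + M))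
  have rD : Module.finrank ℝ D = _ := finrank_map_inj _ (hinj _ (mul_ne_zero hP0 hQ0)) (V M)
  have vA := finrank_V (e + M)
  have vB := finrank_V (d + M)
  have vD := finrank_V M
  have vN := finrank_V N
  change 2 * Module.finrank ℝ (V _) = _ at vA vB vD vN
  simp only [N] at vN r1
  nlinarith

lemma bezout_set (P Q : MvPolynomial (Fin 2) ℝ) (hP : Irreducible P) (hQ : ¬ P ∣ Q) :
    {p | evalRR P p = 0 ∧ evalRR Q p = 0}.Finite ∧
    {p | evalRR P p = 0 ∧ evalRR Q p = 0}.ncard ≤ P.totalDegree * Q.totalDegree := by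
  have hf : {p | evalRR P p = 0 ∧ evalRR Q p = 0}.Finite := by
    by_contra h
    obtain ⟨S, hS, hc⟩ := Set.Infinite.exists_subset_card_eq h (P.totalDegree * Q.totalDegree + 1)
    have := bezout_card P Q hP hQ S (fun p hp => hS hp)
    omega
  refine ⟨hf, ?_⟩
  rw [Set.ncard_eq_toFinset_card _ hf]
  exact bezout_card P Q hP hQ _ (fun p hp => by simpa using hp)

lemma dvd_of_infinite (P Q : MvPolynomial (Fin 2) ℝ) (hP : Irreducible P)
    (h : {p | evalRR P p = 0 ∧ evalRR Q p = 0}.Infinite) : P ∣ Q := by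
  by_contra hQ
  exact h (bezout_set P Q hP hQ).1

open MvPolynomial in
lemma Lop_mul (P A B : MvPolynomial (Fin 2) ℝ) :
    Lop P (A * B) = A * Lop P B + Lop P A * B := by
  simp only [Lop, pderiv_mul]; ring

lemma Lop_self (P : MvPolynomial (Fin 2) ℝ) : Lop P P = 0 := by
  simp only [Lop]; ring

lemma Lop_sum (P : MvPolynomial (Fin 2) ℝ) {ι : Type*} (s : Finset ι)
    (g : ι → MvPolynomial (Fin 2) ℝ) : Lop P (∑ i ∈ s, g i) = ∑ i ∈ s, Lop P (g i) := by
  simp only [Lop, map_sum, Finset.mul_sum, Finset.sum_sub_distrib]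

lemma Lop_dvd (P A : MvPolynomial (Fin 2) ℝ) (h : P ∣ A) : P ∣ Lop P A := by
  obtain ⟨B, rfl⟩ := h
  rw [Lop_mul, Lop_self, zero_mul, add_zero]
  exact dvd_mul_right _ _

open MvPolynomial in
lemma degree_pderiv_le (i : Fin 2) (P : MvPolynomial (Fin 2) ℝ) :
    (pderiv i P).totalDegree ≤ P.totalDegree - 1 := by
  refine Finset.sup_le fun m hm => ?_
  have h1 : coeff (m + Finsupp.single i 1) P ≠ 0 := by
    intro h
    rw [mem_support_iff, coeff_pderiv, h] at hm
    simp at hm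
  have h2 := le_totalDegree (mem_support_iff.mpr h1)
  rw [Finsupp.sum_add_index' (by simp) (by simp)] at h2
  simp at h2
  omega

open MvPolynomial in
lemma not_dvd_pderiv (P : MvPolynomial (Fin 2) ℝ) (hd : 0 < P.totalDegree) :
    ¬ P ∣ pderiv 0 P ∨ ¬ P ∣ pderiv 1 P := by
  by_contra! h
  have hz : ∀ i : Fin 2, P ∣ pderiv i P → pderiv i P = 0 := by
    rintro i ⟨c, hc⟩
    by_contra h0
    have hP : P ≠ 0 := by rintro rfl; simp at hd
    have hc0 : c ≠ 0 := by rintro rfl; simp at hc; exact h0 hc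
    have := degree_pderiv_le i P
    rw [hc, totalDegree_mul_of_isDomain hP hc0] at this
    omega
  have hall : ∀ i : Fin 2, pderiv i P = 0 := by
    intro i
    fin_cases i
    · exact hz _ h.1
    · exact hz _ h.2
  have : P.totalDegree = 0 := by
    rw [totalDegree_eq_zero_iff]
    intro m hm i
    by_contra hmi
    have := coeff_pderiv (i := i) P (m - Finsupp.single i 1)
    rw [hall i, tsub_add_cancel_of_le (by
      rw [Finsupp.single_le_iff]; omega)] at this
    simp only [coeff_zero] at this
    rcases mul_eq_zero.mp this.symm with h | h
    · exact (mem_support_iff.mp hm) h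
    · have : (0:ℝ) ≤ ((m - Finsupp.single i 1 : Fin 2 →₀ ℕ) i : ℝ) := Nat.cast_nonneg _
      push_cast at h
      linarith
  omega

open MvPolynomial in
lemma hasDerivAt_evalRR (P Q : MvPolynomial (Fin 2) ℝ) (γ : ℝ → ℝ × ℝ) (t : ℝ)
    (h : HasDerivAt γ (evalRR (pderiv 1 P) (γ t), - evalRR (pderiv 0 P) (γ t)) t) :
    HasDerivAt (fun s => evalRR Q (γ s)) (evalRR (Lop P Q) (γ t)) t := by
  induction Q using MvPolynomial.induction_on with
  | C a => simpa [evalRR, Lop] using hasDerivAt_const t a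
  | add p q hp hq =>
    have h1 : (fun s => evalRR (p + q) (γ s)) = (fun s => evalRR p (γ s)) + fun s => evalRR q (γ s) := by
      ext s; simp [evalRR]
    have h2 : evalRR (Lop P (p + q)) (γ t) = evalRR (Lop P p) (γ t) + evalRR (Lop P q) (γ t) := by
      simp [evalRR, Lop]; ring
    rw [h1, h2]
    exact hp.add hq
  | mul_X p i hp =>
    have hX : HasDerivAt (fun s => evalRR (X i) (γ s)) (evalRR (Lop P (X i)) (γ t)) t := by
      fin_cases i
      · have := (hasFDerivAt_fst (𝕜 := ℝ) (p := γ t)).comp_hasDerivAt t h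
        simpa [evalRR, Lop, Function.comp_def] using this
      · have := (hasFDerivAt_snd (𝕜 := ℝ) (p := γ t)).comp_hasDerivAt t h
        simpa [evalRR, Lop, Function.comp_def] using this
    have h1 : (fun s => evalRR (p * X i) (γ s)) =
        (fun s => evalRR p (γ s)) * fun s => evalRR (X i) (γ s) := by
      ext s; simp [evalRR]
    have h2 : evalRR (Lop P (p * X i)) (γ t) =
        evalRR (Lop P p) (γ t) * evalRR (X i) (γ t) + evalRR p (γ t) * evalRR (Lop P (X i)) (γ t) := by
      rw [Lop_mul]; simp only [evalRR, map_add, map_mul]; ring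
    rw [h1, h2]
    exact hp.mul hX

open MvPolynomial in
lemma contDiff_evalRR (Q : MvPolynomial (Fin 2) ℝ) : ContDiff ℝ 1 (evalRR Q) := by
  induction Q using MvPolynomial.induction_on with
  | C a =>
    have : evalRR (C a) = fun _ => a := by ext s; simp [evalRR]
    rw [this]; exact contDiff_const
  | add p q hp hq =>
    have : evalRR (p + q) = fun s => evalRR p s + evalRR q s := by ext s; simp [evalRR]
    rw [this]; exact hp.add hq
  | mul_X p i hp =>
    have hX : ContDiff ℝ 1 (evalRR (X i)) := by
      fin_cases i
      · have : evalRR (X 0) = fun s => s.1 := by ext s; simp [evalRR]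
        simpa [this] using contDiff_fst
      · have : evalRR (X 1) = fun s => s.2 := by ext s; simp [evalRR]
        simpa [this] using contDiff_snd
    have : evalRR (p * X i) = fun s => evalRR p s * evalRR (X i) s := by ext s; simp [evalRR]
    rw [this]; exact hp.mul hX

open MvPolynomial in
lemma flow_infinite (P g h : MvPolynomial (Fin 2) ℝ) (p : ℝ × ℝ) (hp : evalRR P p = 0)
    (hsm : evalRR (pderiv 0 P) p ≠ 0 ∨ evalRR (pderiv 1 P) p ≠ 0) (hh : evalRR h p ≠ 0)
    (hdvd : P ∣ h * Lop P g - g * Lop P h) :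
    {q | evalRR P q = 0 ∧ evalRR (g - C (evalRR g p / evalRR h p) * h) q = 0}.Infinite := by
  let v : ℝ × ℝ → ℝ × ℝ := fun q => (evalRR (pderiv 1 P) q, - evalRR (pderiv 0 P) q)
  have hv : ContDiff ℝ 1 v := (contDiff_evalRR _).prodMk (contDiff_evalRR _).neg
  obtain ⟨γ, hγ0, ε, hε, hγ⟩ :=
    hv.contDiffAt.exists_forall_mem_closedBall_exists_eq_forall_mem_Ioo_hasDerivAt₀ (x₀ := p) 0
  rw [zero_sub, zero_add] at hγ
  have hd0 := hγ 0 ⟨by linarith, hε⟩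
  have hc0 : ContinuousAt (fun s => evalRR h (γ s)) 0 :=
    (hasDerivAt_evalRR P h γ 0 hd0).continuousAt
  have hev : ∀ᶠ s in nhds (0:ℝ), evalRR h (γ s) ≠ 0 :=
    hc0.eventually_ne (by simpa [hγ0] using hh)
  obtain ⟨δ', hδ', hball⟩ := Metric.eventually_nhds_iff.mp hev
  set δ := min δ' ε with hδdef
  have hδ : 0 < δ := lt_min hδ' hε
  have hI : ∀ s ∈ Set.Ioo (-δ) δ, HasDerivAt γ (v (γ s)) s ∧ evalRR h (γ s) ≠ 0 := by
    intro s hs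
    have h1 : δ ≤ δ' := min_le_left _ _
    have h2 : δ ≤ ε := min_le_right _ _
    refine ⟨hγ s ⟨by linarith [hs.1], by linarith [hs.2]⟩, hball ?_⟩
    rw [Real.dist_eq, sub_zero, abs_lt]
    exact ⟨by linarith [hs.1], by linarith [hs.2]⟩
  have h0I : (0:ℝ) ∈ Set.Ioo (-δ) δ := ⟨by linarith, hδ⟩
  have hconst : ∀ F : ℝ → ℝ, (∀ s ∈ Set.Ioo (-δ) δ, HasDerivAt F 0 s) →
      ∀ s ∈ Set.Ioo (-δ) δ, F s = F 0 := by
    intro F hF s hs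
    obtain ⟨a, ha⟩ := isOpen_Ioo.exists_is_const_of_deriv_eq_zero (s := Set.Ioo (-δ) δ)
      isPreconnected_Ioo (f := F)
      (fun x hx => (hF x hx).differentiableAt.differentiableWithinAt) (fun x hx => (hF x hx).deriv)
    rw [ha s hs, ha 0 h0I]
  have hPz : ∀ s ∈ Set.Ioo (-δ) δ, evalRR P (γ s) = 0 := by
    intro s hs
    rw [hconst (fun s => evalRR P (γ s)) ?_ s hs, hγ0, hp]
    intro x hx
    have := hasDerivAt_evalRR P P γ x (hI x hx).1
    rw [Lop_self] at this
    simpa [evalRR] using this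
  have hgz : ∀ s ∈ Set.Ioo (-δ) δ, evalRR g (γ s) / evalRR h (γ s) = evalRR g p / evalRR h p := by
    intro s hs
    rw [hconst (fun s => evalRR g (γ s) / evalRR h (γ s)) ?_ s hs, hγ0]
    intro x hx
    have := (hasDerivAt_evalRR P g γ x (hI x hx).1).div (hasDerivAt_evalRR P h γ x (hI x hx).1)
      (hI x hx).2
    refine this.congr_deriv ?_
    obtain ⟨c, hc⟩ := hdvd
    have h3 := congrArg (fun Q => evalRR Q (γ x)) hc
    have h4 := hPz x hx
    simp only [evalRR, map_sub, map_mul] at h3 h4 ⊢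
    rw [h4, zero_mul] at h3
    rw [div_eq_zero_iff]
    left; linarith
  have himg : (γ '' Set.Ioo (-δ) δ).Infinite := by
    apply IsPreconnected.infinite_of_nontrivial
    · refine isPreconnected_Ioo.image _ fun s hs => (hI s hs).1.continuousAt.continuousWithinAt
    · by_contra hnt
      rw [Set.not_nontrivial_iff] at hnt
      have heq : γ =ᶠ[nhds 0] fun _ => p := by
        filter_upwards [Ioo_mem_nhds h0I.1 h0I.2] with s hs
        rw [← hγ0]
        exact hnt ⟨s, hs, rfl⟩ ⟨0, h0I, rfl⟩
      have h5 := ((hasDerivAt_const (0:ℝ) p).congr_of_eventuallyEq heq).unique hd0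
      rw [hγ0] at h5
      simp only [v, Prod.ext_iff, Prod.fst_zero, Prod.snd_zero] at h5
      rcases hsm with h6 | h6
      · apply h6; linarith [h5.2]
      · exact h6 h5.1.symm
  refine himg.mono ?_
  rintro _ ⟨s, hs, rfl⟩
  refine ⟨hPz s hs, ?_⟩
  have h1 := hgz s hs
  have h2 := (hI s hs).2
  rw [← h1]
  simp only [evalRR, map_sub, map_mul, eval_C] at h2 ⊢
  field_simp
  ring

open MvPolynomial in
lemma const_lemma (P : MvPolynomial (Fin 2) ℝ) (hP : Irreducible P) (hd : 0 < P.totalDegree)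
    (hΓ : {p | evalRR P p = 0}.Infinite) (g h : MvPolynomial (Fin 2) ℝ) (hh : ¬ P ∣ h)
    (hdvd : P ∣ h * Lop P g - g * Lop P h) : ∃ t : ℝ, P ∣ g - C t * h := by
  obtain ⟨i, hi⟩ : ∃ i : Fin 2, ¬ P ∣ pderiv i P := by
    rcases not_dvd_pderiv P hd with h | h
    · exact ⟨0, h⟩
    · exact ⟨1, h⟩
  have f1 := (bezout_set P _ hP hi).1
  have f2 := (bezout_set P _ hP hh).1
  obtain ⟨p, hp, hpn⟩ := (hΓ.sdiff (f1.union f2)).nonempty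
  have hp' : evalRR P p = 0 := hp
  simp only [Set.mem_union, Set.mem_ofPred_eq, hp', true_and, not_or] at hpn
  refine ⟨evalRR g p / evalRR h p, dvd_of_infinite _ _ hP
    (flow_infinite P g h p hp' ?_ hpn.2 hdvd)⟩
  fin_cases i
  · exact Or.inl hpn.1
  · exact Or.inr hpn.1

open MvPolynomial in
lemma monomialEnum_linearIndependent (k μ : ℕ) (f : Fin μ → MvPolynomial (Fin 2) ℝ)
    (hf : IsMonomialEnum k f) : LinearIndependent ℝ f := by
  have h1 : ∀ m, ∃ s : Fin 2 →₀ ℕ, f m = monomial s 1 := by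
    intro m
    have : f m ∈ Set.range f := ⟨m, rfl⟩
    rw [hf.2] at this
    obtain ⟨a, b, -, h⟩ := this
    refine ⟨Finsupp.single 0 a + Finsupp.single 1 b, ?_⟩
    rw [h, X_pow_eq_monomial, X_pow_eq_monomial, monomial_mul, one_mul]
  choose s hs using h1
  have hinj : Function.Injective s := by
    intro a b hab
    apply hf.1
    rw [hs, hs, hab]
  have := (basisMonomials (Fin 2) ℝ).linearIndependent.comp s hinj
  have hfs : f = (basisMonomials (Fin 2) ℝ) ∘ s := by
    funext m
    simp [hs]
  rw [hfs]
  exact this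

open MvPolynomial in
lemma monomialEnum_degree (k μ : ℕ) (f : Fin μ → MvPolynomial (Fin 2) ℝ)
    (hf : IsMonomialEnum k f) (m : Fin μ) : (f m).totalDegree ≤ k := by
  have : f m ∈ Set.range f := ⟨m, rfl⟩
  rw [hf.2] at this
  obtain ⟨a, b, hab, h⟩ := this
  rw [h]
  refine (totalDegree_mul _ _).trans ?_
  rw [totalDegree_X_pow, totalDegree_X_pow]
  exact hab

open MvPolynomial in
lemma wronskian_not_dvd (P : MvPolynomial (Fin 2) ℝ) (hP : Irreducible P)
    (hΓ : {p | evalRR P p = 0}.Infinite) (k : ℕ) (hk : k < P.totalDegree) (μ : ℕ)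
    (f : Fin μ → MvPolynomial (Fin 2) ℝ) (hf : IsMonomialEnum k f) (j : ℕ) :
    ∀ hj : j ≤ μ, ¬ P ∣ xiWronskian P f j hj := by
  have hPp : Prime P := hP.prime
  induction j with
  | zero =>
    intro hj h
    rw [xiWronskian, Matrix.det_isEmpty] at h
    exact hP.not_isUnit (isUnit_of_dvd_one h)
  | succ n ih =>
    intro hj hD
    have hn : n ≤ μ := by omega
    have hWn := ih hn
    set W := xiWronskian P f n hn with hWdef
    let F : Fin (n + 1) → MvPolynomial (Fin 2) ℝ := fun m => f (Fin.castLE hj m)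
    let M : Matrix (Fin (n + 1)) (Fin (n + 1)) (MvPolynomial (Fin 2) ℝ) :=
      Matrix.of fun i m => (Lop P)^[(i : ℕ)] (F m)
    have hD' : P ∣ M.det := hD
    let N : Fin (n + 1) → MvPolynomial (Fin 2) ℝ := fun m => M.adjugate m (Fin.last n)
    let M' : Matrix (Fin n) (Fin n) (MvPolynomial (Fin 2) ℝ) :=
      Matrix.of fun i m => (Lop P)^[(i : ℕ)] (f (Fin.castLE hn m))
    have hM' : M'.det = W := rfl
    have hMM' : ∀ i m : Fin n, M i.castSucc m.castSucc = M' i m := fun i m => rfl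
    have hNlast : N (Fin.last n) = W := by
      simp only [N]
      rw [Matrix.adjugate_fin_succ_eq_det_submatrix, ← hM']
      have : M.submatrix (Fin.last n).succAbove (Fin.last n).succAbove = M' := by
        ext1 i m
        simp only [Matrix.submatrix_apply, Fin.succAbove_last]
        exact hMM' i m
      rw [this, Even.neg_one_pow (by simp), one_mul]
    have hrow : ∀ i, P ∣ ∑ m, M i m * N m := by
      intro i
      have h1 := congrFun (congrFun (Matrix.mul_adjugate M) i) (Fin.last n)
      rw [Matrix.mul_apply] at h1
      simp only [N]
      rw [h1, Matrix.smul_apply, smul_eq_mul]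
      exact hD'.mul_right _
    have hML : ∀ (i : Fin n) m, Lop P (M i.castSucc m) = M i.succ m := by
      intro i m
      simp only [M, Matrix.of_apply, Fin.val_castSucc, Fin.val_succ]
      rw [Function.iterate_succ_apply']
    have hrow' : ∀ i : Fin n, P ∣ ∑ m, M i.castSucc m * Lop P (N m) := by
      intro i
      have h1 := Lop_dvd P _ (hrow i.castSucc)
      rw [Lop_sum] at h1
      simp only [Lop_mul, hML, Finset.sum_add_distrib] at h1
      exact (dvd_add_left (hrow i.succ)).mp h1
    let u : Fin (n + 1) → MvPolynomial (Fin 2) ℝ := fun m => W * Lop P (N m) - N m * Lop P W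
    have hulast : u (Fin.last n) = 0 := by simp only [u, hNlast]; ring
    have hu1 : ∀ i : Fin n, P ∣ ∑ m : Fin n, M' i m * u m.castSucc := by
      intro i
      have h1 : P ∣ ∑ m, M i.castSucc m * u m := by
        have : ∑ m, M i.castSucc m * u m = W * (∑ m, M i.castSucc m * Lop P (N m))
            - Lop P W * ∑ m, M i.castSucc m * N m := by
          simp only [u, Finset.mul_sum, ← Finset.sum_sub_distrib]
          refine Finset.sum_congr rfl fun m _ => ?_
          ring
        rw [this]
        exact dvd_sub ((hrow' i).mul_left _) ((hrow _).mul_left _)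
      rw [Fin.sum_univ_castSucc, hulast, mul_zero, add_zero] at h1
      exact h1
    have hu2 : ∀ m : Fin n, P ∣ u m.castSucc := by
      intro m
      have h1 : M'.adjugate.mulVec (M'.mulVec fun m => u m.castSucc) m = W * u m.castSucc := by
        rw [Matrix.mulVec_mulVec, Matrix.adjugate_mul, hM', Matrix.smul_mulVec, Matrix.one_mulVec]
        rfl
      have h2 : P ∣ W * u m.castSucc := by
        rw [← h1]
        change P ∣ ∑ i, M'.adjugate m i * (M'.mulVec fun m => u m.castSucc) i
        refine Finset.dvd_sum fun i _ => ?_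
        exact Dvd.dvd.mul_left (hu1 i) _
      exact (hPp.dvd_or_dvd h2).resolve_left hWn
    have hu : ∀ m, P ∣ u m := by
      intro m
      refine Fin.lastCases ?_ (fun m => hu2 m) m
      rw [hulast]; exact dvd_zero _
    have ht : ∀ m, ∃ t : ℝ, P ∣ N m - C t * W := fun m =>
      const_lemma P hP (by omega) hΓ (N m) W hWn (hu m)
    choose t ht using ht
    have htl : t (Fin.last n) ≠ 0 := by
      intro h0
      have := ht (Fin.last n)
      rw [h0, hNlast, map_zero, zero_mul, sub_zero] at this
      exact hWn this
    have hfin : P ∣ ∑ m, C (t m) * F m := by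
      have h1 : P ∣ W * ∑ m, C (t m) * F m := by
        have : W * ∑ m, C (t m) * F m = (∑ m, M 0 m * N m) - ∑ m, F m * (N m - C (t m) * W) := by
          rw [Finset.mul_sum, ← Finset.sum_sub_distrib]
          refine Finset.sum_congr rfl fun m _ => ?_
          have : M 0 m = F m := rfl
          rw [this]; ring
        rw [this]
        exact dvd_sub (hrow 0) (Finset.dvd_sum fun m _ => (ht m).mul_left _)
      exact (hPp.dvd_or_dvd h1).resolve_left hWn
    have hdeg : (∑ m, C (t m) * F m).totalDegree ≤ k := by
      refine totalDegree_finsetSum_le fun m _ => ?_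
      refine (totalDegree_mul _ _).trans ?_
      rw [totalDegree_C, zero_add]
      exact monomialEnum_degree k μ f hf _
    have hzero : ∑ m, C (t m) * F m = 0 := by
      obtain ⟨c, hc⟩ := hfin
      by_contra h0
      rw [hc] at hdeg h0
      rw [totalDegree_mul_of_isDomain (left_ne_zero_of_mul h0) (right_ne_zero_of_mul h0)] at hdeg
      omega
    have hli : LinearIndependent ℝ F :=
      (monomialEnum_linearIndependent k μ f hf).comp _ (Fin.castLE_injective hj)
    refine htl (Fintype.linearIndependent_iff.mp hli t ?_ _)
    simpa [C_mul'] using hzero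

open MvPolynomial in
lemma degree_Lop_iter (P Q : MvPolynomial (Fin 2) ℝ) (i : ℕ) :
    ((Lop P)^[i] Q).totalDegree ≤ Q.totalDegree + i * P.totalDegree := by
  induction i with
  | zero => simp
  | succ i ih =>
    rw [Function.iterate_succ_apply']
    have key : ∀ A : MvPolynomial (Fin 2) ℝ,
        (Lop P A).totalDegree ≤ A.totalDegree + P.totalDegree := by
      intro A
      have a0 := degree_pderiv_le 0 P
      have a1 := degree_pderiv_le 1 P
      have b0 := degree_pderiv_le 0 A
      have b1 := degree_pderiv_le 1 A
      refine (totalDegree_sub _ _).trans (max_le ?_ ?_) <;>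
        refine (totalDegree_mul _ _).trans ?_ <;> omega
    have := key ((Lop P)^[i] Q)
    rw [add_mul, one_mul]
    omega

open MvPolynomial in
lemma degree_wronskian (P : MvPolynomial (Fin 2) ℝ) (k : ℕ) (hk : k < P.totalDegree) (μ : ℕ)
    (f : Fin μ → MvPolynomial (Fin 2) ℝ) (hf : IsMonomialEnum k f) (j : ℕ) (hj : j ≤ μ) :
    (xiWronskian P f j hj).totalDegree ≤ μ ^ 2 * P.totalDegree := by
  rw [xiWronskian, Matrix.det_apply]
  refine totalDegree_finsetSum_le fun σ _ => ?_
  have h1 : ∀ (u : ℤˣ) (A : MvPolynomial (Fin 2) ℝ), (u • A).totalDegree ≤ A.totalDegree := by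
    intro u A
    rcases Int.units_eq_one_or u with rfl | rfl
    · simp
    · simp
  refine (h1 _ _).trans ((totalDegree_finsetProd _ _).trans ?_)
  refine (Finset.sum_le_card_nsmul _ _ (μ * P.totalDegree) fun m _ => ?_).trans ?_
  · simp only [Matrix.of_apply]
    refine (degree_Lop_iter _ _ _).trans ?_
    have h2 := monomialEnum_degree k μ f hf (Fin.castLE hj m)
    have h3 : ((σ m : Fin j) : ℕ) + 1 ≤ μ := by omega
    calc _ ≤ P.totalDegree + (σ m : ℕ) * P.totalDegree := by omega
      _ = ((σ m : ℕ) + 1) * P.totalDegree := by ring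
      _ ≤ _ := Nat.mul_le_mul_right _ h3
  · simp only [Finset.card_univ, Fintype.card_fin, smul_eq_mul]
    rw [pow_two, mul_assoc]
    exact Nat.mul_le_mul_right _ hj

theorem curve_inter_SigmaSet_finite :
    ∃ c e : ℝ, 0 < c ∧ 0 < e ∧
      ∀ (P : MvPolynomial (Fin 2) ℝ), Irreducible P →
      ∀ d : ℕ, d = P.totalDegree →
      ∀ Γ : Set (ℝ × ℝ), Γ = {p | evalRR P p = 0} → Γ.Infinite →
      ∀ k : ℕ, 1 ≤ k → k < d →
      ∀ μ : ℕ, μ = (k + 1) * (k + 2) / 2 →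
      ∀ f : Fin μ → MvPolynomial (Fin 2) ℝ, IsMonomialEnum k f →
        (Γ ∩ SigmaSet P f).Finite ∧
        ((Γ ∩ SigmaSet P f).ncard : ℝ) ≤ c * (d : ℝ) ^ 2 * (k : ℝ) ^ e := by
  refine ⟨28, 6, by norm_num, by norm_num, ?_⟩
  intro P hP d hd Γ hΓdef hΓ k hk1 hkd μ hμ f hf
  subst hΓdef
  rw [hd] at hkd
  have hd0 : 0 < P.totalDegree := by omega
  obtain ⟨i, hi⟩ : ∃ i : Fin 2, ¬ P ∣ MvPolynomial.pderiv i P := by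
    rcases not_dvd_pderiv P hd0 with h | h
    · exact ⟨0, h⟩
    · exact ⟨1, h⟩
  obtain ⟨f1, c1⟩ := bezout_set P _ hP hi
  set Z : MvPolynomial (Fin 2) ℝ → Set (ℝ × ℝ) :=
    fun Q => {p | evalRR P p = 0 ∧ evalRR Q p = 0} with hZ
  let W : Fin (μ + 1) → MvPolynomial (Fin 2) ℝ := fun j => xiWronskian P f j (by omega)
  have hB : ∀ j, (Z (W j)).Finite ∧ (Z (W j)).ncard ≤ P.totalDegree * (μ ^ 2 * P.totalDegree) := by
    intro j
    obtain ⟨h1, h2⟩ := bezout_set P _ hP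
      (wronskian_not_dvd P hP hΓ k hkd μ f hf j (by omega))
    exact ⟨h1, h2.trans (Nat.mul_le_mul_left _ (degree_wronskian P k hkd μ f hf j _))⟩
  have hsub : {p | evalRR P p = 0} ∩ SigmaSet P f ⊆
      Z (MvPolynomial.pderiv i P) ∪ ⋃ j ∈ (Finset.univ.erase (0 : Fin (μ + 1))), Z (W j) := by
    rintro p ⟨hp, hs⟩
    rcases hs with ⟨h0, h1, -⟩ | ⟨j, hj, hj1, h⟩
    · left
      refine ⟨hp, ?_⟩
      fin_cases i
      · exact h0
      · exact h1
    · right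
      simp only [Set.mem_iUnion]
      refine ⟨⟨j, by omega⟩, ?_, hp, h⟩
      simp [Fin.ext_iff]
      omega
  have hfin : (⋃ j ∈ (Finset.univ.erase (0 : Fin (μ + 1))), Z (W j)).Finite :=
    Set.Finite.biUnion (Finset.finite_toSet _) fun j _ => (hB j).1
  have hfin2 := f1.union hfin
  refine ⟨hfin2.subset hsub, ?_⟩
  have hcard : ({p | evalRR P p = 0} ∩ SigmaSet P f).ncard ≤
      P.totalDegree * P.totalDegree + μ * (P.totalDegree * (μ ^ 2 * P.totalDegree)) := by
    refine (Set.ncard_le_ncard hsub hfin2).trans ((Set.ncard_union_le _ _).trans ?_)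
    refine add_le_add (c1.trans (Nat.mul_le_mul_left _ ?_)) ?_
    · exact (degree_pderiv_le i P).trans (Nat.sub_le _ _)
    · refine (Finset.set_ncard_biUnion_le _ _).trans ?_
      refine (Finset.sum_le_card_nsmul _ _ _ fun j _ => (hB j).2).trans ?_
      simp
  have hμk : μ ≤ 3 * k ^ 2 := by
    rw [hμ]
    apply Nat.div_le_of_le_mul
    nlinarith
  have hreal : (({p | evalRR P p = 0} ∩ SigmaSet P f).ncard : ℝ) ≤
      (d : ℝ) ^ 2 * (1 + (μ : ℝ) ^ 3) := by
    rw [hd]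
    calc _ ≤ ((P.totalDegree * P.totalDegree +
          μ * (P.totalDegree * (μ ^ 2 * P.totalDegree)) : ℕ) : ℝ) := by exact_mod_cast hcard
      _ = _ := by push_cast; ring
  have hμr : (μ : ℝ) ≤ 3 * (k : ℝ) ^ 2 := by exact_mod_cast hμk
  have hk1r : (1 : ℝ) ≤ k := by exact_mod_cast hk1
  have h6 : (k : ℝ) ^ (6 : ℝ) = (k : ℝ) ^ 6 := by
    rw [← Real.rpow_natCast]; norm_num
  rw [h6]
  have h3 : (μ : ℝ) ^ 3 ≤ (3 * (k : ℝ) ^ 2) ^ 3 := by gcongr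
  have h1 : (1 : ℝ) ≤ (k : ℝ) ^ 6 := one_le_pow₀ hk1r
  refine hreal.trans ?_
  calc (d : ℝ) ^ 2 * (1 + (μ : ℝ) ^ 3) ≤ (d : ℝ) ^ 2 * (28 * (k : ℝ) ^ 6) := by
        gcongr
        nlinarith
    _ = _ := by ring
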